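/- Let P be a polynomial with complex coefficients of degree n, let a be a complex number with |a| ≤ 1, and let β be a complex number with |β| ≤ 1. Then for every real R ≥ 1 and every complex z with |z| ≥ 1, |S̃_a[P](Rz) + β·((R+1)/2)^n·S̃_a[P](z)| ≤ |R^n + β·((R+1)/2)^n| · n|z|^(n−1) · max_{|w|=1} |P(w)|. -/

import Mathlib

open Polynomial

/-- The modified Smirnov operator: S̃ₐ[P](z) = (1+az)·P′(z) − n·a·P(z). -/
noncomputable def smirnov (n : ℕ) (a : ℂ) (P : Polynomial ℂ) (z : ℂ) : ℂ :=
  (1 + a * z) * P.derivative.eval z - (n : ℂ) * a * P.eval z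

/-- The maximum of ‖P‖ on the unit circle. -/
noncomputable def maxCircle (P : Polynomial ℂ) : ℝ :=
  sSup {y : ℝ | ∃ w : ℂ, ‖w‖ = 1 ∧ y = ‖P.eval w‖}

lemma norm_eval_le_maxCircle (P : Polynomial ℂ) {w : ℂ} (hw : ‖w‖ = 1) :
    ‖P.eval w‖ ≤ maxCircle P := by
  have hbdd : BddAbove ((fun w : ℂ => ‖P.eval w‖) '' Metric.sphere 0 1) :=
    (isCompact_sphere (0 : ℂ) 1).bddAbove_image (by fun_prop)
  refine le_csSup (hbdd.mono ?_) ⟨w, hw, rfl⟩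
  rintro y ⟨v, hv, rfl⟩
  exact ⟨v, by simpa using hv, rfl⟩

lemma norm_eval_reflect_le {m : ℕ} {Q : Polynomial ℂ} (hQ : Q.natDegree ≤ m) {M : ℝ}
    (hM : ∀ w : ℂ, ‖w‖ = 1 → ‖Q.eval w‖ ≤ M) {z : ℂ} (hz : ‖z‖ ≤ 1) :
    ‖(reflect m Q).eval z‖ ≤ M := by
  refine Complex.norm_le_of_forall_mem_frontier_norm_le (U := Metric.ball 0 1)
    (f := fun z => (reflect m Q).eval z) Metric.isBounded_ball
    (Polynomial.differentiable _).diffContOnCl ?_ ?_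
  · intro w hw
    rw [frontier_ball _ one_ne_zero] at hw
    replace hw : ‖w‖ = 1 := by simpa using hw
    have hw0 : w⁻¹ ≠ 0 := inv_ne_zero (norm_ne_zero_iff.1 (by rw [hw]; exact one_ne_zero))
    let := invertibleOfNonzero hw0
    have h := eval₂_reflect_mul_pow (RingHom.id ℂ) w⁻¹ m Q hQ
    simp only [invOf_eq_inv, inv_inv] at h
    have h' := congrArg norm h
    rw [norm_mul, norm_pow, norm_inv, hw, inv_one, one_pow, mul_one] at h'
    exact h'.trans_le (hM _ (by rw [norm_inv, hw, inv_one]))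
  · rw [closure_ball _ one_ne_zero]
    simpa using hz

lemma norm_coeff_le {m : ℕ} {Q : Polynomial ℂ} (hQ : Q.natDegree ≤ m) {M : ℝ}
    (hM : ∀ w : ℂ, ‖w‖ = 1 → ‖Q.eval w‖ ≤ M) : ‖Q.coeff m‖ ≤ M := by
  have h := norm_eval_reflect_le hQ hM (z := 0) (by simp)
  rwa [← coeff_zero_eq_eval_zero, coeff_reflect, revAt_le (Nat.zero_le m), Nat.sub_zero] at h

lemma norm_eval_le_mul_pow {m : ℕ} {Q : Polynomial ℂ} (hQ : Q.natDegree ≤ m) {M : ℝ}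
    (hM : ∀ w : ℂ, ‖w‖ = 1 → ‖Q.eval w‖ ≤ M) {z : ℂ} (hz : 1 ≤ ‖z‖) :
    ‖Q.eval z‖ ≤ M * ‖z‖ ^ m := by
  have hz0 : z ≠ 0 := norm_pos_iff.1 (by linarith)
  let := invertibleOfNonzero hz0
  have h := eval₂_reflect_mul_pow (RingHom.id ℂ) z m Q hQ
  rw [invOf_eq_inv] at h
  have h' := congrArg norm h
  rw [norm_mul, norm_pow] at h'
  refine h'.symm.trans_le (mul_le_mul_of_nonneg_right ?_ (by positivity))
  exact norm_eval_reflect_le hQ hM (by rw [norm_inv]; exact inv_le_one_of_one_le₀ hz)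

section Perturbation

variable {m : ℕ} {Q : Polynomial ℂ} {M : ℝ} {l : ℂ}

lemma natDegree_add_C_mul_X_pow (hQ : Q.natDegree ≤ m) (hM0 : 0 < M)
    (hM : ∀ w : ℂ, ‖w‖ = 1 → ‖Q.eval w‖ ≤ M) (hl : 1 < ‖l‖) :
    (Q + C (l * M) * X ^ m).natDegree = m := by
  refine natDegree_eq_of_le_of_coeff_ne_zero
    (natDegree_add_le_of_degree_le hQ (natDegree_C_mul_X_pow_le _ _)) ?_
  rw [coeff_add, coeff_C_mul, coeff_X_pow_self, mul_one]
  intro h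
  have h1 := norm_coeff_le hQ hM
  rw [eq_neg_of_add_eq_zero_left h, norm_neg, norm_mul, Complex.norm_of_nonneg hM0.le] at h1
  nlinarith

lemma eval_add_C_mul_X_pow_ne_zero (hQ : Q.natDegree ≤ m) (hM0 : 0 < M)
    (hM : ∀ w : ℂ, ‖w‖ = 1 → ‖Q.eval w‖ ≤ M) (hl : 1 < ‖l‖) {z : ℂ} (hz : 1 ≤ ‖z‖) :
    (Q + C (l * M) * X ^ m).eval z ≠ 0 := by
  intro h
  simp only [eval_add, eval_mul, eval_C, eval_pow, eval_X] at h
  have h1 := norm_eval_le_mul_pow hQ hM hz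
  rw [eq_neg_of_add_eq_zero_left h, norm_neg, norm_mul, norm_mul, norm_pow,
    Complex.norm_of_nonneg hM0.le] at h1
  have : 0 < M * ‖z‖ ^ m := by positivity
  nlinarith

lemma norm_lt_one_of_mem_roots_add_C_mul_X_pow (hQ : Q.natDegree ≤ m) (hM0 : 0 < M)
    (hM : ∀ w : ℂ, ‖w‖ = 1 → ‖Q.eval w‖ ≤ M) (hl : 1 < ‖l‖) {r : ℂ}
    (hr : r ∈ (Q + C (l * M) * X ^ m).roots) : ‖r‖ < 1 := by
  by_contra! h
  exact eval_add_C_mul_X_pow_ne_zero hQ hM0 hM hl h (mem_roots'.1 hr).2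

end Perturbation

lemma half_mul_norm_sub_le {R : ℝ} (hR : 1 ≤ R) {z r : ℂ} (h : ‖r‖ ≤ ‖z‖) :
    (R + 1) / 2 * ‖z - r‖ ≤ ‖(R : ℂ) * z - r‖ := by
  have h2 : ‖r‖ ^ 2 ≤ ‖z‖ ^ 2 := by gcongr
  have h3 : ‖z - r‖ ^ 2 ≤ (2 * ‖z‖) ^ 2 := by
    have := norm_sub_le z r
    gcongr
    linarith
  refine le_of_sq_le_sq ?_ (norm_nonneg _)
  simp only [mul_pow, Complex.sq_norm, Complex.normSq_apply, Complex.sub_re, Complex.sub_im,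
    Complex.mul_re, Complex.mul_im, Complex.ofReal_re, Complex.ofReal_im] at *
  nlinarith [mul_nonneg (sub_nonneg.2 hR) (sub_nonneg.2 h2),
    mul_nonneg (mul_nonneg (sub_nonneg.2 hR) (sub_nonneg.2 hR)) (sub_nonneg.2 h3)]

lemma pow_card_mul_norm_prod_sub_le {R : ℝ} (hR : 1 ≤ R) {z : ℂ} (s : Multiset ℂ)
    (hs : ∀ r ∈ s, ‖r‖ ≤ ‖z‖) :
    ((R + 1) / 2) ^ s.card * ‖(s.map fun r => z - r).prod‖
      ≤ ‖(s.map fun r => (R : ℂ) * z - r).prod‖ := by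
  induction s using Multiset.induction_on with
  | empty => simp
  | cons r s ih =>
    have h1 := half_mul_norm_sub_le hR (hs r (Multiset.mem_cons_self r s))
    have h2 := ih fun t ht => hs t (Multiset.mem_cons_of_mem ht)
    have hx : 0 ≤ (R + 1) / 2 := by linarith
    simp only [Multiset.map_cons, Multiset.prod_cons, Multiset.card_cons, norm_mul]
    calc _ = ((R + 1) / 2 * ‖z - r‖)
          * (((R + 1) / 2) ^ s.card * ‖(s.map fun r => z - r).prod‖) := by ring
      _ ≤ _ := by gcongr

lemma pow_natDegree_mul_norm_eval_le {R : ℝ} (hR : 1 ≤ R) {z : ℂ} {F : Polynomial ℂ}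
    (hF : ∀ r ∈ F.roots, ‖r‖ ≤ ‖z‖) :
    ((R + 1) / 2) ^ F.natDegree * ‖F.eval z‖ ≤ ‖F.eval ((R : ℂ) * z)‖ := by
  have hs := IsAlgClosed.splits F
  rw [hs.eval_eq_prod_roots, hs.eval_eq_prod_roots, hs.natDegree_eq_card_roots, norm_mul, norm_mul,
    mul_left_comm]
  gcongr
  exact pow_card_mul_norm_prod_sub_le hR _ hF

lemma half_lt_re_div_sub {z r : ℂ} (h : ‖r‖ < ‖z‖) : 1 / 2 < (z / (z - r)).re := by
  have hne : z - r ≠ 0 := fun h0 => by rw [sub_eq_zero.1 h0] at h; exact lt_irrefl _ h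
  have hpos : 0 < Complex.normSq (z - r) := Complex.normSq_pos.2 hne
  have h2 : ‖r‖ ^ 2 < ‖z‖ ^ 2 := by gcongr
  rw [Complex.div_re, ← add_div, lt_div_iff₀ hpos]
  simp only [Complex.sq_norm, Complex.normSq_apply, Complex.sub_re, Complex.sub_im] at *
  nlinarith

lemma half_card_lt_re_sum {z : ℂ} (s : Multiset ℂ) (hs : ∀ r ∈ s, ‖r‖ < ‖z‖) :
    s = 0 ∨ (s.card : ℝ) / 2 < (s.map fun r => z / (z - r)).sum.re := by
  induction s using Multiset.induction_on with
  | empty => simp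
  | cons r s ih =>
    right
    have h1 := half_lt_re_div_sub (hs r (Multiset.mem_cons_self r s))
    simp only [Multiset.map_cons, Multiset.sum_cons, Multiset.card_cons, Complex.add_re]
    push_cast
    rcases ih fun t ht => hs t (Multiset.mem_cons_of_mem ht) with rfl | h2
    · simpa using h1
    · linarith

lemma smirnov_ne_zero {n : ℕ} (hn : n ≠ 0) {F : Polynomial ℂ} (hd : F.natDegree = n) {a z : ℂ}
    (ha : ‖a‖ ≤ 1) (hz : ‖z‖ = 1) (hF : ∀ r ∈ F.roots, ‖r‖ < 1) : smirnov n a F z ≠ 0 := by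
  have hs := IsAlgClosed.splits F
  have hF0 : F ≠ 0 := by rintro rfl; exact hn (by simpa using hd.symm)
  have hFz : F.eval z ≠ 0 := fun h => (hF z ((mem_roots hF0).2 h)).ne hz
  set W := z * (F.derivative.eval z / F.eval z) with hW
  have hre : (n : ℝ) / 2 < W.re := by
    rw [hW, hs.eval_derivative_div_eval_of_ne_zero hFz, ← Multiset.sum_map_mul_left]
    simp only [mul_one_div]
    rcases half_card_lt_re_sum F.roots (z := z) (by rwa [hz]) with h | h
    · rw [hs.natDegree_eq_card_roots, h] at hd
      exact absurd hd.symm hn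
    · rwa [← hs.natDegree_eq_card_roots, hd] at h
  have hlt : ‖W - n‖ < ‖W‖ := by
    have hn0 : (0 : ℝ) < n := by positivity
    refine lt_of_pow_lt_pow_left₀ 2 (norm_nonneg _) ?_
    simp only [Complex.sq_norm, Complex.normSq_apply, Complex.sub_re, Complex.sub_im,
      Complex.natCast_re, Complex.natCast_im]
    nlinarith
  intro h0
  have key : W + a * z * (W - n) = 0 := by
    have : W + a * z * (W - n) = z * smirnov n a F z / F.eval z := by
      rw [hW, smirnov]; field_simp; ring
    rw [this, h0]; simp
  have : ‖W‖ ≤ ‖W - n‖ := by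
    have hWe := congrArg norm (eq_neg_of_add_eq_zero_left key)
    rw [norm_neg, norm_mul (a * z), norm_mul a, hz, mul_one] at hWe
    exact hWe.trans_le <| mul_le_of_le_one_left (norm_nonneg _) ha
  linarith

lemma smirnov_add_C_mul_X_pow (n : ℕ) (a c : ℂ) (P : Polynomial ℂ) (z : ℂ) :
    smirnov n a (P + C c * X ^ n) z = smirnov n a P z + c * n * z ^ (n - 1) := by
  rcases n with _ | m
  · simp [smirnov]
  · simp [smirnov]; ring

lemma norm_smirnov_le {n : ℕ} (hn : n ≠ 0) {P : Polynomial ℂ} (hP : P.natDegree ≤ n) {M : ℝ}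
    (hM0 : 0 < M) (hM : ∀ w : ℂ, ‖w‖ = 1 → ‖P.eval w‖ ≤ M) {a z : ℂ} (ha : ‖a‖ ≤ 1)
    (hz : ‖z‖ = 1) : ‖smirnov n a P z‖ ≤ n * M := by
  by_contra! h
  have hn0 : (0 : ℝ) < n := by positivity
  have hz0 : z ≠ 0 := norm_ne_zero_iff.1 (by rw [hz]; exact one_ne_zero)
  set l : ℂ := -smirnov n a P z / (M * n * z ^ (n - 1)) with hl
  have hl1 : 1 < ‖l‖ := by
    rw [hl, norm_div, norm_neg, norm_mul, norm_mul, norm_pow, hz, Complex.norm_of_nonneg hM0.le,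
      Complex.norm_natCast, one_pow, mul_one, one_lt_div (by positivity), mul_comm]
    exact h
  refine smirnov_ne_zero hn (natDegree_add_C_mul_X_pow hP hM0 hM hl1) ha hz
    (fun r => norm_lt_one_of_mem_roots_add_C_mul_X_pow hP hM0 hM hl1) ?_
  rw [smirnov_add_C_mul_X_pow, hl]
  have : (M : ℂ) ≠ 0 := by exact_mod_cast hM0.ne'
  have : (n : ℂ) ≠ 0 := by exact_mod_cast hn
  field_simp
  ring

/-- If all perturbations of `u`, `v` by multiples of `k`, `V k` satisfy a lower growth bound by `t`,
then `v + w u` is dominated by `(V + w) k` for all `‖w‖ ≤ t`. -/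
lemma norm_add_mul_le_of_forall {u v k : ℂ} {V t : ℝ} (hk : k ≠ 0) (ht : 0 < t) (htV : t ≤ V)
    (h : ∀ l : ℂ, 1 < ‖l‖ → u + l * k ≠ 0 ∧ t * ‖u + l * k‖ ≤ ‖v + l * (V * k)‖)
    {β : ℂ} (hβ : ‖β‖ ≤ 1) : ‖v + β * t * u‖ ≤ ‖(V : ℂ) + β * t‖ * ‖k‖ := by
  have hlt : ∀ s : ℝ, s ∈ Set.Ico (0 : ℝ) 1 →
      ‖v + s * β * t * u‖ ≤ ‖(V : ℂ) + s * β * t‖ * ‖k‖ := by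
    intro s hs
    by_contra! hgt
    have hw : ‖(s : ℂ) * β * t‖ < t := by
      rw [norm_mul, norm_mul, Complex.norm_of_nonneg hs.1, Complex.norm_of_nonneg ht.le]
      nlinarith [hs.1, hs.2, norm_nonneg β, mul_nonneg hs.1 (sub_nonneg.2 hβ)]
    generalize (s : ℂ) * β * t = w at *
    have hVw : (V : ℂ) + w ≠ 0 := by
      intro h0
      rw [eq_neg_of_add_eq_zero_right h0, norm_neg, Complex.norm_of_nonneg (ht.le.trans htV)] at hw
      linarith
    have hpos : 0 < ‖(V : ℂ) + w‖ * ‖k‖ := by positivity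
    set l : ℂ := -(v + w * u) / ((V + w) * k) with hl
    have hl1 : 1 < ‖l‖ := by
      rw [hl, norm_div, norm_neg, norm_mul, one_lt_div hpos]
      exact hgt
    obtain ⟨h1, h2⟩ := h l hl1
    have h3 : v + l * (V * k) = -(w * (u + l * k)) := by
      rw [hl]; field_simp; ring
    rw [h3, norm_neg, norm_mul] at h2
    have := norm_pos_iff.2 h1
    nlinarith
  have hcl : (1 : ℝ) ∈ closure (Set.Ico (0 : ℝ) 1) := by
    rw [closure_Ico zero_ne_one]; simp
  have := closure_minimal (s := Set.Ico (0 : ℝ) 1)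
    (t := {s : ℝ | ‖v + s * β * t * u‖ ≤ ‖(V : ℂ) + s * β * t‖ * ‖k‖}) hlt
    (isClosed_le (by fun_prop) (by fun_prop)) hcl
  simpa using this

lemma norm_eval_add_mul_le {m : ℕ} {Q : Polynomial ℂ} (hQ : Q.natDegree ≤ m) {M : ℝ}
    (hM0 : 0 < M) (hM : ∀ w : ℂ, ‖w‖ = 1 → ‖Q.eval w‖ ≤ M) {R : ℝ} (hR : 1 ≤ R) {β z : ℂ}
    (hβ : ‖β‖ ≤ 1) (hz : 1 ≤ ‖z‖) :
    ‖Q.eval ((R : ℂ) * z) + β * ((((R + 1) / 2) ^ (m + 1) : ℝ) : ℂ) * Q.eval z‖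
      ≤ ‖((R ^ (m + 1) : ℝ) : ℂ) + β * ((((R + 1) / 2) ^ (m + 1) : ℝ) : ℂ)‖
        * ‖(M : ℂ) * z ^ m‖ := by
  have hz0 : z ≠ 0 := norm_pos_iff.1 (by linarith)
  have hMc : (M : ℂ) ≠ 0 := by exact_mod_cast hM0.ne'
  have hx : 0 < (R + 1) / 2 := by linarith
  refine norm_add_mul_le_of_forall (by positivity) (by positivity)
    (pow_le_pow_left₀ hx.le (by linarith) _) (fun l hl => ?_) hβ
  have hev : ∀ y : ℂ, Q.eval y + l * (M * y ^ m) = (Q + C (l * M) * X ^ m).eval y := by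
    intro y; simp [mul_assoc]
  refine ⟨hev z ▸ eval_add_C_mul_X_pow_ne_zero hQ hM0 hM hl hz, ?_⟩
  have h1 := pow_natDegree_mul_norm_eval_le hR (z := z) (F := Q + C (l * M) * X ^ m) fun r hr =>
    (norm_lt_one_of_mem_roots_add_C_mul_X_pow hQ hM0 hM hl hr).le.trans hz
  rw [natDegree_add_C_mul_X_pow hQ hM0 hM hl, ← hev, ← hev] at h1
  have hRz : 1 ≤ ‖(R : ℂ) * z‖ := by
    rw [norm_mul, Complex.norm_of_nonneg (by linarith)]
    nlinarith
  have hdom : ‖-Q.eval ((R : ℂ) * z)‖ ≤ ‖l * (M * ((R : ℂ) * z) ^ m)‖ := by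
    rw [norm_neg, norm_mul, norm_mul, norm_pow, Complex.norm_of_nonneg hM0.le]
    exact (norm_eval_le_mul_pow hQ hM hRz).trans (le_mul_of_one_le_left (by positivity) hl.le)
  have h2 := half_mul_norm_sub_le hR hdom
  calc _ = (R + 1) / 2 * (((R + 1) / 2) ^ m * ‖Q.eval z + l * (M * z ^ m)‖) := by ring
    _ ≤ (R + 1) / 2 * ‖Q.eval ((R : ℂ) * z) + l * (M * ((R : ℂ) * z) ^ m)‖ := by gcongr
    _ = (R + 1) / 2 * ‖l * (M * ((R : ℂ) * z) ^ m) - -Q.eval ((R : ℂ) * z)‖ := by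
      rw [sub_neg_eq_add, add_comm (eval _ _)]
    _ ≤ _ := h2
    _ = _ := by congr 1; push_cast; ring

/-- The polynomial whose values are given by `smirnov`. -/
noncomputable def smirnovPoly (n : ℕ) (a : ℂ) (P : Polynomial ℂ) : Polynomial ℂ :=
  derivative P + C a * (X * derivative P) - C (n * a) * P

lemma eval_smirnovPoly (n : ℕ) (a : ℂ) (P : Polynomial ℂ) (z : ℂ) :
    (smirnovPoly n a P).eval z = smirnov n a P z := by
  simp [smirnovPoly, smirnov]; ring

lemma natDegree_smirnovPoly_le {m : ℕ} (a : ℂ) {P : Polynomial ℂ} (hP : P.natDegree ≤ m + 1) :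
    (smirnovPoly (m + 1) a P).natDegree ≤ m := by
  refine natDegree_le_iff_coeff_eq_zero.2 fun N hN => ?_
  obtain ⟨k, rfl⟩ := Nat.exists_eq_add_of_lt hN
  have h1 : P.coeff (m + k + 1 + 1) = 0 := coeff_eq_zero_of_natDegree_lt (by omega)
  simp only [smirnovPoly, coeff_sub, coeff_add, coeff_C_mul, coeff_X_mul, coeff_derivative, h1]
  rcases k with _ | k
  · simp; ring
  · have h2 : P.coeff (m + (k + 1) + 1) = 0 := coeff_eq_zero_of_natDegree_lt (by omega)
    rw [h2]; ring

theorem statement2 (n : ℕ) (P : Polynomial ℂ) (hP : P.natDegree = n)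
    (a β : ℂ) (ha : ‖a‖ ≤ 1) (hβ : ‖β‖ ≤ 1)
    (R : ℝ) (hR : 1 ≤ R) (z : ℂ) (hz : 1 ≤ ‖z‖) :
    ‖smirnov n a P ((R : ℂ) * z) + β * ((((R + 1) / 2) ^ n : ℝ) : ℂ) * smirnov n a P z‖
      ≤ ‖(R : ℂ) ^ n + β * ((((R + 1) / 2) ^ n : ℝ) : ℂ)‖
        * ((n : ℝ) * ‖z‖ ^ (n - 1)) * maxCircle P := by
  rcases n with _ | m
  · simp [smirnov, derivative_of_natDegree_zero hP]
  have hM := fun w (hw : ‖w‖ = 1) => norm_eval_le_maxCircle P hw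
  have hM0 : 0 < maxCircle P := by
    refine (norm_pos_iff.2 ?_).trans_le (norm_coeff_le hP.le hM)
    rw [← hP, coeff_natDegree, leadingCoeff_ne_zero]
    rintro rfl
    simp at hP
  have hn0 : (0 : ℝ) < (m + 1 : ℕ) := by positivity
  have h := norm_eval_add_mul_le (natDegree_smirnovPoly_le a hP.le) (mul_pos hn0 hM0)
    (fun w hw => by
      rw [eval_smirnovPoly]; exact norm_smirnov_le m.succ_ne_zero hP.le hM0 hM ha hw) hR hβ hz
  rw [eval_smirnovPoly, eval_smirnovPoly, norm_mul, norm_pow,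
    Complex.norm_of_nonneg (mul_pos hn0 hM0).le, Complex.ofReal_pow R] at h
  refine h.trans_eq ?_
  rw [Nat.add_sub_cancel]
  ring
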